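/- There is an absolute constant c > 0 such that the following holds for all t, n with n ≤ t/100 and all p ∈ (0,1). Let M be a k-pass streaming algorithm with s bits of memory on streams in [t]^n, together with an output bit that is a (possibly randomized) function of the final memory state M_{(k,n)}. If Pr[output = 1 when X ∼ D0] + Pr[output = 0 when X ∼ D1] ≤ 0.01, then k·s·p²·n ≥ c. -/

import Mathlib

open scoped Classical
open Finset

noncomputable section

namespace MultiPassIC

/-- Probability of an event under a probability mass function `p` on a finite sample space. -/
def pr {Ω : Type} [Fintype Ω] (p : Ω → ℝ) (E : Ω → Prop) : ℝ :=
  ∑ ω, if E ω then p ω else 0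

/-- `p` is a probability mass function on the finite type `Ω`. -/
structure IsPMF {Ω : Type} [Fintype Ω] (p : Ω → ℝ) : Prop where
  nonneg : ∀ ω, 0 ≤ p ω
  sum_one : ∑ ω, p ω = 1

/-- Shannon entropy (base 2) of the random variable `A` under `p`. -/
def H {Ω : Type} [Fintype Ω] {α : Type} [Fintype α] (p : Ω → ℝ) (A : Ω → α) : ℝ :=
  -∑ a, pr p (fun ω => A ω = a) * Real.logb 2 (pr p (fun ω => A ω = a))

/-- Conditional mutual information `I(A ; B ∣ C)` (base 2), with the usual conventions
for vanishing probabilities. -/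
def condMI {Ω : Type} [Fintype Ω] {α β γ : Type} [Fintype α] [Fintype β] [Fintype γ]
    (p : Ω → ℝ) (A : Ω → α) (B : Ω → β) (C : Ω → γ) : ℝ :=
  ∑ a, ∑ b, ∑ c,
    pr p (fun ω => A ω = a ∧ B ω = b ∧ C ω = c) *
      Real.logb 2 ((pr p (fun ω => C ω = c) *
          pr p (fun ω => A ω = a ∧ B ω = b ∧ C ω = c)) /
        (pr p (fun ω => A ω = a ∧ C ω = c) * pr p (fun ω => B ω = b ∧ C ω = c)))

/-- Mutual information `I(A ; B)` (base 2). -/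
def MI {Ω : Type} [Fintype Ω] {α β : Type} [Fintype α] [Fintype β]
    (p : Ω → ℝ) (A : Ω → α) (B : Ω → β) : ℝ :=
  condMI p A B (fun _ => (0 : Fin 1))

/-- `X 0, …, X (n-1)` (the first `n` stream elements) are mutually independent under `p`,
i.e. they are drawn from a product distribution. -/
def IsProduct {Ω : Type} [Fintype Ω] {𝒳 : Type} (p : Ω → ℝ) (n : ℕ) (X : ℕ → Ω → 𝒳) : Prop :=
  ∀ x : ℕ → 𝒳,
    pr p (fun ω => ∀ j < n, X j ω = x j) =
      ∏ j ∈ Finset.range n, pr p (fun ω => X j ω = x j)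

/-- A `k`-pass streaming algorithm on the input stream `X 0, …, X (n-1)` (0-indexed;
the paper's `X_j` is `X (j-1)`), over a finite sample space `Ω` with pmf `p`.
`S` is the finite set of memory states, `Rv` the value space of the per-step private
randomness, `init` the initial memory state `M₀`, `R i j` the private randomness used at
step `j` of pass `i` (0-indexed), and `f i j` the corresponding transition function.
The field `indep` states that the initial state, all the per-step random seeds, and the
input stream are mutually independent. -/
structure Alg (Ω : Type) [Fintype Ω] (p : Ω → ℝ) (𝒳 : Type) [Fintype 𝒳]
    (n k : ℕ) (X : ℕ → Ω → 𝒳) where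
  S : Type
  fintS : Fintype S
  Rv : Type
  fintR : Fintype Rv
  init : Ω → S
  R : ℕ → ℕ → Ω → Rv
  f : ℕ → ℕ → 𝒳 → S → Rv → S
  indep : ∀ (m : S) (r : ℕ → ℕ → Rv) (x : ℕ → 𝒳),
    pr p (fun ω => init ω = m ∧ (∀ i < k, ∀ j < n, R i j ω = r i j) ∧ (∀ j < n, X j ω = x j))
      = pr p (fun ω => init ω = m)
        * (∏ i ∈ Finset.range k, ∏ j ∈ Finset.range n, pr p (fun ω => R i j ω = r i j))
        * pr p (fun ω => ∀ j < n, X j ω = x j)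

attribute [instance] Alg.fintS Alg.fintR

variable {Ω : Type} [Fintype Ω] {p : Ω → ℝ} {𝒳 : Type} [Fintype 𝒳] {n k : ℕ} {X : ℕ → Ω → 𝒳}

/-- Running pass `i` (0-indexed) of the algorithm for `j` steps starting from `ini`. -/
def Alg.runPass (M : Alg Ω p 𝒳 n k X) (i : ℕ) (ini : Ω → M.S) : ℕ → Ω → M.S
  | 0 => ini
  | j + 1 => fun ω =>
      if j < n ∧ i < k then
        M.f i j (X j ω) (M.runPass i ini j ω) (M.R i j ω)
      else M.runPass i ini j ω

/-- `M.passEnd i` is the memory state at the end of pass `i`; `M.passEnd 0 = M₀` is the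
initial state, and `M.passEnd i` is the paper's `M_i = M_{(i,n)}`. -/
def Alg.passEnd (M : Alg Ω p 𝒳 n k X) : ℕ → Ω → M.S
  | 0 => M.init
  | i + 1 => M.runPass i (M.passEnd i) n

/-- `M.st i j` is the memory state after reading `j` elements in pass `i+1`;
it is the paper's `M_{(i+1, j)}`. -/
def Alg.st (M : Alg Ω p 𝒳 n k X) (i j : ℕ) : Ω → M.S :=
  M.runPass i (M.passEnd i) j

/-- The multi-pass information cost
`MIC(M, μ) = Σ_{i=1}^{k} Σ_{j=1}^{n} Σ_{ℓ=1}^{j} I(M_{(i,j)}; X_ℓ | M_{(≤i,ℓ-1)}, M_{(≤i-1,j)})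
  + Σ_{i=1}^{k} Σ_{j=1}^{n} Σ_{ℓ=j+1}^{n} I(M_{(i,j)}; X_ℓ | M_{(≤i-1,ℓ-1)}, M_{(≤i-1,j)})`
(all summation indices below are 0-indexed shifts of the paper's 1-indexed ones). -/
def Alg.MIC (M : Alg Ω p 𝒳 n k X) : ℝ :=
  (∑ i ∈ Finset.range k, ∑ j ∈ Finset.range n, ∑ l ∈ Finset.range (j + 1),
    condMI p (M.st i (j + 1)) (X l)
      (fun ω => ((fun r : Fin (i + 1) => M.st r.1 l ω),
                 (fun r : Fin i => M.st r.1 (j + 1) ω))))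
  + (∑ i ∈ Finset.range k, ∑ j ∈ Finset.range n, ∑ l ∈ Finset.Ico (j + 1) n,
    condMI p (M.st i (j + 1)) (X l)
      (fun ω => ((fun r : Fin i => M.st r.1 l ω),
                 (fun r : Fin i => M.st r.1 (j + 1) ω))))

/-- The conditional information cost
`MIC_cond(M, μ) = Σ_{j=1}^{n} Σ_{ℓ=1}^{j} I(M_{(≤k,j)}; X_ℓ | M_{<k}, M_{(≤k,ℓ-1)})`. -/
def Alg.MICcond (M : Alg Ω p 𝒳 n k X) : ℝ :=
  ∑ j ∈ Finset.range n, ∑ l ∈ Finset.range (j + 1),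
    condMI p (fun ω => fun r : Fin k => M.st r.1 (j + 1) ω) (X l)
      (fun ω => ((fun r : Fin k => M.passEnd r.1 ω),
                 (fun r : Fin k => M.st r.1 l ω)))

end MultiPassIC

namespace MultiPassIC

/-- The needle distribution `D1` with needle probability `q` as a probability mass
function on `[t]^n`: first a needle `α` is drawn uniformly from `[t]`, then each
coordinate independently equals `α` with probability `q` and is otherwise uniform. -/
def needlePMF (t n : ℕ) (q : ℝ) (x : Fin n → Fin t) : ℝ :=
  ∑ α : Fin t, (1 / (t : ℝ)) *
    ∏ j : Fin n, (if x j = α then q + (1 - q) / t else (1 - q) / t)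

/-- A deterministic multi-pass computation on `[t]^n`, recorded position by position: `traj x j`
collects the memory states of all passes at position `j`, each position acts by `step`, and the
first and last entries are coupled by `bdry`, which determines the whole trajectory. -/
structure CyclicRun (n t : ℕ) (V : Type) where
  step : ℕ → Fin t → V → V
  bdry : V → V → Prop
  traj : (Fin n → Fin t) → ℕ → V
  traj_succ : ∀ (x : Fin n → Fin t) (j : Fin n), traj x (j + 1) = step j (x j) (traj x j)
  traj_bdry : ∀ x, bdry (traj x 0) (traj x n)
  traj_unique : ∀ (x : Fin n → Fin t) (v : ℕ → V),
    (∀ j : Fin n, v (j + 1) = step j (x j) (v j)) → bdry (v 0) (v n) → ∀ j ≤ n, v j = traj x j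

/-- The stream that agrees with `x` on `[a, b)` and with `y` elsewhere. -/
def splice {n t : ℕ} (a b : ℕ) (x y : Fin n → Fin t) : Fin n → Fin t :=
  fun j => if a ≤ j ∧ j < b then x j else y j

lemma splice_splice {n t : ℕ} (a b : ℕ) (x y : Fin n → Fin t) :
    splice a b (splice a b x y) (splice a b y x) = x := by
  funext j
  by_cases h : a ≤ j.val ∧ j.val < b <;> simp [splice, h]

namespace CyclicRun

variable {n t : ℕ} {V : Type} (C : CyclicRun n t V)

/-- The two streams pass through the same states at positions `a` and `b`. -/
def Agree (a b : ℕ) (x y : Fin n → Fin t) : Prop :=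
  C.traj x a = C.traj y a ∧ C.traj x b = C.traj y b

lemma traj_splice {a b : ℕ} (hab : a < b) (hb : b ≤ n) {x y : Fin n → Fin t}
    (h : C.Agree a b x y) {j : ℕ} (hj : j ≤ n) :
    C.traj (splice a b x y) j = if a ≤ j ∧ j ≤ b then C.traj x j else C.traj y j := by
  obtain ⟨h1, h2⟩ := h
  symm
  refine C.traj_unique (splice a b x y)
    (fun j => if a ≤ j ∧ j ≤ b then C.traj x j else C.traj y j) ?_ ?_ j hj
  · intro i
    have hx := C.traj_succ x i
    have hy := C.traj_succ y i
    rcases lt_trichotomy i.val b with hib | hib | hib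
    · rcases lt_trichotomy (i.val + 1) a with hia | hia | hia
      · simp only [splice]
        rw [if_neg (by omega), if_neg (by omega), if_neg (by omega), hy]
      · simp only [splice]
        rw [if_pos (by omega), if_neg (by omega), if_neg (by omega), ← hy, hia, h1]
      · simp only [splice]
        rw [if_pos (by omega), if_pos (by omega), if_pos (by omega), hx]
    · simp only [splice]
      rw [if_neg (by omega), if_neg (by omega), if_pos (by omega), hy, hib, h2]
    · simp only [splice]
      rw [if_neg (by omega), if_neg (by omega), if_neg (by omega), hy]
  · have e0 : (if a ≤ 0 ∧ 0 ≤ b then C.traj x 0 else C.traj y 0) = C.traj y 0 := by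
      split_ifs with h
      · obtain rfl : a = 0 := by omega
        exact h1
      · rfl
    have en : (if a ≤ n ∧ n ≤ b then C.traj x n else C.traj y n) = C.traj y n := by
      split_ifs with h
      · obtain rfl : b = n := by omega
        exact h2
      · rfl
    simp only [e0, en]
    exact C.traj_bdry y

lemma traj_splice_outer {a b : ℕ} (hab : a < b) (hb : b ≤ n) {x y : Fin n → Fin t}
    (h : C.Agree a b x y) {j : ℕ} (hj : j ≤ n) (hout : j ≤ a ∨ b ≤ j) :
    C.traj (splice a b x y) j = C.traj y j := by
  rw [C.traj_splice hab hb h hj]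
  split_ifs with h'
  · rcases hout with ho | ho
    · obtain rfl : j = a := by omega
      exact h.1
    · obtain rfl : j = b := by omega
      exact h.2
  · rfl

lemma agree_splice {a b : ℕ} (hab : a < b) (hb : b ≤ n) {x y : Fin n → Fin t}
    (h : C.Agree a b x y) : C.Agree a b (splice a b x y) y :=
  ⟨C.traj_splice_outer hab hb h (by omega) (Or.inl le_rfl),
    C.traj_splice_outer hab hb h hb (Or.inr le_rfl)⟩

/-- The posterior probability that entry `a` equals `z`, given the states at `a` and `b`
(these states being given as `v` and `w`). -/
def post (a : Fin n) (b : ℕ) (z : Fin t) (v w : V) : ℝ :=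
  (∑ y : Fin n → Fin t, if C.traj y a = v ∧ C.traj y b = w ∧ y a = z then (1 : ℝ) else 0) /
    ∑ y : Fin n → Fin t, if C.traj y a = v ∧ C.traj y b = w then (1 : ℝ) else 0

/-- `post`, evaluated at the states visited on input `x`. -/
def postAt (a : Fin n) (b : ℕ) (z : Fin t) (x : Fin n → Fin t) : ℝ :=
  C.post a b z (C.traj x a) (C.traj x b)

lemma card_agree_pos (a b : ℕ) (x : Fin n → Fin t) :
    0 < ∑ y : Fin n → Fin t, if C.traj y a = C.traj x a ∧ C.traj y b = C.traj x b
      then (1 : ℝ) else 0 := by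
  refine Finset.sum_pos' (fun y _ => by split_ifs <;> norm_num) ⟨x, mem_univ _, by simp⟩

lemma post_nonneg (a : Fin n) (b : ℕ) (z : Fin t) (v w : V) : 0 ≤ C.post a b z v w :=
  div_nonneg (Finset.sum_nonneg fun y _ => by split_ifs <;> norm_num)
    (Finset.sum_nonneg fun y _ => by split_ifs <;> norm_num)

lemma sum_post_le_one (a : Fin n) (b : ℕ) (v w : V) : ∑ z, C.post a b z v w ≤ 1 := by
  unfold post
  rw [← Finset.sum_div, Finset.sum_comm]
  have : ∀ y : Fin n → Fin t,
      (∑ z, if C.traj y a = v ∧ C.traj y b = w ∧ y a = z then (1 : ℝ) else 0) =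
        if C.traj y a = v ∧ C.traj y b = w then (1 : ℝ) else 0 := by
    intro y
    by_cases h1 : C.traj y a = v <;> by_cases h2 : C.traj y b = w <;> simp [h1, h2]
  simp only [this]
  exact div_self_le_one _

lemma sum_postAt (a : Fin n) (b : ℕ) (x : Fin n → Fin t) : ∑ z, C.postAt a b z x = 1 := by
  unfold postAt post
  rw [← Finset.sum_div, Finset.sum_comm]
  have : ∀ y : Fin n → Fin t,
      (∑ z, if C.traj y a = C.traj x a ∧ C.traj y b = C.traj x b ∧ y a = z
        then (1 : ℝ) else 0) =
        if C.traj y a = C.traj x a ∧ C.traj y b = C.traj x b then (1 : ℝ) else 0 := by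
    intro y
    by_cases h1 : C.traj y a = C.traj x a <;> by_cases h2 : C.traj y b = C.traj x b <;>
      simp [h1, h2]
  simp only [this]
  exact div_self (C.card_agree_pos a b x).ne'

lemma postAt_self_pos (a : Fin n) (b : ℕ) (x : Fin n → Fin t) : 0 < C.postAt a b (x a) x := by
  refine div_pos ?_ (C.card_agree_pos a b x)
  exact Finset.sum_pos' (fun y _ => by split_ifs <;> norm_num) ⟨x, mem_univ _, by simp⟩

/-- Conditional independence: a quantity not affected by changing the block `[a, b)` (among streams
through the same states at `a` and `b`) only sees the entry `a` through its posterior. -/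
lemma sum_mul_indicator (a : Fin n) {b : ℕ} (hab : a < b) (hb : b ≤ n) (z : Fin t)
    (f : (Fin n → Fin t) → ℝ) (hf : ∀ x y, C.Agree a b x y → f (splice a b x y) = f y) :
    ∑ x, f x * (if x a = z then 1 else 0) = ∑ x, f x * C.postAt a b z x := by
  set N : (Fin n → Fin t) → ℝ := fun x => ∑ y : Fin n → Fin t,
    if C.traj y a = C.traj x a ∧ C.traj y b = C.traj x b then (1 : ℝ) else 0 with hN
  have hNpos : ∀ x, 0 < N x := C.card_agree_pos a b
  have hNagree : ∀ x y, C.Agree a b x y → N x = N y := by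
    intro x y h
    simp only [hN, h.1, h.2]
  have hsymm : ∀ x y, C.Agree a b x y → C.Agree a b y x := fun x y h => ⟨h.1.symm, h.2.symm⟩
  set T : (Fin n → Fin t) × (Fin n → Fin t) → ℝ := fun q =>
    if C.Agree a b q.2 q.1 then f q.1 * (if q.1 a = z then 1 else 0) / N q.1 else 0 with hT
  set U : (Fin n → Fin t) × (Fin n → Fin t) → ℝ := fun q =>
    if C.Agree a b q.2 q.1 then f q.1 * (if q.2 a = z then 1 else 0) / N q.1 else 0 with hU
  have hL : ∑ x, f x * (if x a = z then 1 else 0) = ∑ q, T q := by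
    rw [Fintype.sum_prod_type]
    refine Finset.sum_congr rfl fun x _ => ?_
    have : ∀ y, T (x, y) = (f x * (if x a = z then 1 else 0) / N x) *
        (if C.traj y a = C.traj x a ∧ C.traj y b = C.traj x b then (1 : ℝ) else 0) := by
      intro y
      simp only [hT, Agree, mul_ite, mul_one, mul_zero]
    simp only [this]
    rw [← Finset.mul_sum]
    exact (div_mul_cancel₀ _ (hNpos x).ne').symm
  have hR : ∑ x, f x * C.postAt a b z x = ∑ q, U q := by
    rw [Fintype.sum_prod_type]
    refine Finset.sum_congr rfl fun x _ => ?_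
    have : ∀ y, U (x, y) = f x * ((if C.traj y a = C.traj x a ∧ C.traj y b = C.traj x b ∧ y a = z
        then (1 : ℝ) else 0) / N x) := by
      intro y
      simp only [hU, Agree]
      by_cases h1 : C.traj y a = C.traj x a <;> by_cases h2 : C.traj y b = C.traj x b <;>
        by_cases h3 : y a = z <;> simp [h1, h2, h3, div_eq_mul_inv]
    simp only [this]
    rw [← Finset.mul_sum, ← Finset.sum_div]
    rfl
  rw [hL, hR]
  have hinv : Function.Involutive
      (fun q : (Fin n → Fin t) × (Fin n → Fin t) =>
        if C.Agree a b q.2 q.1 then (splice a b q.2 q.1, splice a b q.1 q.2) else q) := by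
    rintro ⟨x, y⟩
    by_cases h : C.Agree a b y x
    · have h1 := C.agree_splice hab hb h
      have h2 := C.agree_splice hab hb (hsymm _ _ h)
      have h3 : C.Agree a b (splice a b x y) (splice a b y x) :=
        ⟨h2.1.trans (h.1.trans h1.1.symm), h2.2.trans (h.2.trans h1.2.symm)⟩
      simp only [h, h3, if_true]
      rw [splice_splice, splice_splice]
    · simp [h]
  refine (Fintype.sum_equiv hinv.toPerm _ _ ?_).symm
  rintro ⟨x, y⟩
  simp only [Function.Involutive.coe_toPerm]
  by_cases h : C.Agree a b y x
  · have h1 := C.agree_splice hab hb h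
    have h2 := C.agree_splice hab hb (hsymm _ _ h)
    have h3 : C.Agree a b (splice a b x y) (splice a b y x) :=
      ⟨h2.1.trans (h.1.trans h1.1.symm), h2.2.trans (h.2.trans h1.2.symm)⟩
    simp only [hT, hU, h, h3, if_true, hf y x h, hNagree _ _ h1]
    have : splice a b y x a = y a := by simp [splice, hab]
    simp only [this]
  · simp [hT, hU, h]

end CyclicRun

/-- Running the position maps `step` from the state `v`. -/
def freeRun {n t : ℕ} {V : Type} (step : ℕ → Fin t → V → V) (v : V) (x : Fin n → Fin t) : ℕ → V
  | 0 => v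
  | j + 1 => if h : j < n then step j (x ⟨j, h⟩) (freeRun step v x j) else freeRun step v x j

lemma freeRun_cons {n t : ℕ} {V : Type} (step : ℕ → Fin t → V → V) (v : V) (z : Fin t)
    (x : Fin n → Fin t) (j : ℕ) :
    freeRun step v (Fin.cons z x : Fin (n + 1) → Fin t) (j + 1) =
      freeRun (fun i => step (i + 1)) (step 0 z v) x j := by
  induction j with
  | zero => simp [freeRun]
  | succ j ih =>
    rw [freeRun, ih]
    conv_rhs => rw [freeRun]
    by_cases h : j < n
    · rw [dif_pos h, dif_pos (by omega)]
      have : (⟨j + 1, by omega⟩ : Fin (n + 1)) = Fin.succ ⟨j, h⟩ := rfl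
      rw [this, Fin.cons_succ]
    · rw [dif_neg h, dif_neg (by omega)]

/-- A product of adapted nonnegative factors, each of conditional mean at most one, has mean at
most one. -/
lemma sum_prod_freeRun_le {t : ℕ} {V : Type} (n : ℕ) (step : ℕ → Fin t → V → V) (v : V)
    (r : ℕ → Fin t → V → ℝ) (hr : ∀ a z w, 0 ≤ r a z w) (hsum : ∀ a w, ∑ z, r a z w ≤ t) :
    ∑ x : Fin n → Fin t, ∏ a : Fin n, r a (x a) (freeRun step v x a) ≤ (t : ℝ) ^ n := by
  induction n generalizing step v r with
  | zero => simp
  | succ n ih =>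
    rw [← (Fin.consEquiv fun _ : Fin (n + 1) => Fin t).sum_comp, Fintype.sum_prod_type]
    calc _ = ∑ z, r 0 z v * ∑ x : Fin n → Fin t, ∏ a : Fin n, r (a + 1) (x a)
          (freeRun (fun i => step (i + 1)) (step 0 z v) x a) := by
          refine Finset.sum_congr rfl fun z _ => ?_
          rw [Finset.mul_sum]
          refine Finset.sum_congr rfl fun x _ => ?_
          rw [Fin.prod_univ_succ]
          simp [Fin.consEquiv, freeRun_cons, freeRun]
      _ ≤ ∑ z, r 0 z v * (t : ℝ) ^ n := by
          refine Finset.sum_le_sum fun z _ => mul_le_mul_of_nonneg_left ?_ (hr _ _ _)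
          exact ih (fun i => step (i + 1)) (step 0 z v) (fun a => r (a + 1))
            (fun a => hr (a + 1)) (fun a => hsum (a + 1))
      _ ≤ (t : ℝ) ^ (n + 1) := by
          rw [← Finset.sum_mul, pow_succ']
          exact mul_le_mul_of_nonneg_right (hsum 0 v) (by positivity)

lemma neg_log_half_le {r : ℝ} (hr : 0 ≤ r) :
    -Real.log ((1 + r) / 2) ≤ (1 - r) / 2 + (1 - r) + r * Real.log r := by
  obtain ⟨s, hs, rfl⟩ : ∃ s : ℝ, 0 ≤ s ∧ r = s ^ 2 := ⟨√r, Real.sqrt_nonneg r, (Real.sq_sqrt hr).symm⟩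
  have h1 : 2 * s ^ 2 - 2 * s ≤ s ^ 2 * Real.log (s ^ 2) := by
    rcases hs.eq_or_lt with rfl | hs
    · simp
    · have := Real.one_sub_inv_le_log_of_pos hs
      rw [Real.log_pow]
      have h2 : s ^ 2 * (1 - s⁻¹) ≤ s ^ 2 * Real.log s := by gcongr
      have h3 : s ^ 2 * (1 - s⁻¹) = s ^ 2 - s := by field_simp
      push_cast
      linarith
  have hp : 0 < (1 + s ^ 2) / 2 := by positivity
  have h2 := Real.one_sub_inv_le_log_of_pos hp
  have h3 : ((1 + s ^ 2) / 2)⁻¹ - 1 ≤ (1 - s ^ 2) / 2 + (1 - s) ^ 2 := by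
    rw [inv_eq_one_div, div_sub_one hp.ne', div_le_iff₀ hp]
    nlinarith [sq_nonneg ((1 - s) ^ 2), sq_nonneg (1 - s), mul_nonneg hs (sq_nonneg (1 - s)),
      mul_nonneg (sq_nonneg s) (sq_nonneg (1 - s))]
  nlinarith

namespace CyclicRun

variable {n t : ℕ} {V : Type} (C : CyclicRun n t V)

lemma traj_eq_freeRun (x : Fin n → Fin t) {j : ℕ} (hj : j ≤ n) :
    C.traj x j = freeRun C.step (C.traj x 0) x j := by
  induction j with
  | zero => rfl
  | succ j ih =>
    rw [freeRun, dif_pos (by omega), ← ih (by omega)]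
    exact C.traj_succ x ⟨j, by omega⟩

/-- The likelihood ratio of entry `a` against the half-planted needle `z`, averaged given the
states at `a` and `b`. -/
def ratio (a : Fin n) (b : ℕ) (z : Fin t) (x : Fin n → Fin t) : ℝ :=
  (1 + t * C.postAt a b z x) / 2

lemma postAt_nonneg (a : Fin n) (b : ℕ) (z : Fin t) (x : Fin n → Fin t) :
    0 ≤ C.postAt a b z x := C.post_nonneg _ _ _ _ _

lemma ratio_pos (a : Fin n) (b : ℕ) (z : Fin t) (x : Fin n → Fin t) : 0 < C.ratio a b z x := by
  have := C.postAt_nonneg a b z x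
  unfold ratio
  positivity

lemma sum_mul_likelihood (a : Fin n) {b : ℕ} (hab : a < b) (hb : b ≤ n) (z : Fin t)
    (f : (Fin n → Fin t) → ℝ) (hf : ∀ x y, C.Agree a b x y → f (splice a b x y) = f y) :
    ∑ x, f x * ((1 + t * (if x a = z then 1 else 0)) / 2) = ∑ x, f x * C.ratio a b z x := by
  have h := C.sum_mul_indicator a hab hb z f hf
  have e1 : ∀ x : Fin n → Fin t, f x * ((1 + t * (if x a = z then 1 else 0)) / 2) =
      f x / 2 + t / 2 * (f x * (if x a = z then 1 else 0)) := fun x => by ring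
  have e2 : ∀ x : Fin n → Fin t, f x * C.ratio a b z x =
      f x / 2 + t / 2 * (f x * C.postAt a b z x) := fun x => by unfold ratio; ring
  simp only [e1, e2, Finset.sum_add_distrib, ← Finset.mul_sum, h]

lemma ratio_splice {a b : ℕ} (hab : a < b) (hb : b ≤ n) {x y : Fin n → Fin t}
    (h : C.Agree a b x y) (i : Fin n) {j : ℕ} (z : Fin t) (hj : j ≤ n)
    (hi : i ≤ a ∨ b ≤ i) (hj' : j ≤ a ∨ b ≤ j) :
    C.ratio i j z (splice a b x y) = C.ratio i j z y := by
  unfold ratio postAt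
  rw [C.traj_splice_outer hab hb h i.2.le hi, C.traj_splice_outer hab hb h hj hj']

/-- All the planted positions in `S` can be replaced simultaneously by posterior averages, where
`nx j` is the planted position following `j`, or `n`. -/
lemma sum_mul_prod_likelihood (S : Finset (Fin n)) (nx : Fin n → ℕ)
    (hlt : ∀ j ∈ S, j < nx j) (hle : ∀ j ∈ S, nx j ≤ n)
    (hgap : ∀ j ∈ S, ∀ i ∈ S, i.val ≤ j ∨ nx j ≤ i)
    (hmem : ∀ j ∈ S, nx j = n ∨ ∃ b ∈ S, b.val = nx j) (z : Fin t) (g : V → ℝ) :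
    ∑ x, g (C.traj x n) * ∏ j ∈ S, ((1 + t * (if x j = z then 1 else 0)) / 2 : ℝ) =
      ∑ x, g (C.traj x n) * ∏ j ∈ S, C.ratio j (nx j) z x := by
  have key : ∀ D : Finset (Fin n), D ⊆ S →
      ∑ x, g (C.traj x n) * ∏ j ∈ S, ((1 + t * (if x j = z then 1 else 0)) / 2 : ℝ) =
      ∑ x, g (C.traj x n) * (∏ j ∈ S \ D, ((1 + t * (if x j = z then 1 else 0)) / 2 : ℝ)) *
        ∏ j ∈ D, C.ratio j (nx j) z x := by
    intro D
    induction D using Finset.induction_on with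
    | empty => simp
    | insert a D ha ih =>
      intro hD
      have haS : a ∈ S := hD (mem_insert_self _ _)
      have hDS : D ⊆ S := fun i hi => hD (mem_insert_of_mem hi)
      rw [ih hDS]
      have haD : a ∈ S \ D := by simp [haS, ha]
      have hsd : (S \ D).erase a = S \ insert a D := by
        ext i
        simp only [mem_erase, mem_sdiff, mem_insert]
        tauto
      have main := C.sum_mul_likelihood a (hlt a haS) (hle a haS) z
        (fun x => g (C.traj x n) *
          (∏ j ∈ S \ insert a D, ((1 + t * (if x j = z then 1 else 0)) / 2 : ℝ)) *
            ∏ j ∈ D, C.ratio j (nx j) z x) ?_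
      · calc _ = _ := ?_
          _ = _ := main
          _ = _ := ?_
        · refine Finset.sum_congr rfl fun x _ => ?_
          rw [← Finset.mul_prod_erase _ _ haD, hsd]
          ring
        · refine Finset.sum_congr rfl fun x _ => ?_
          rw [Finset.prod_insert ha]
          ring
      · intro x y h
        have hb := hle a haS
        have hab := hlt a haS
        rw [C.traj_splice_outer hab hb h le_rfl (Or.inr hb)]
        congr 1
        · congr 1
          refine Finset.prod_congr rfl fun i hi => ?_
          have hiS : i ∈ S := (mem_sdiff.1 hi).1
          have hia : i ≠ a := fun h' => (mem_sdiff.1 hi).2 (h' ▸ mem_insert_self _ _)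
          have hia' : i.val ≠ a.val := fun h' => hia (Fin.ext h')
          have : splice a (nx a) x y i = y i := by
            have := hgap a haS i hiS
            simp only [splice]
            rw [if_neg (by omega)]
          simp only [this]
        · refine Finset.prod_congr rfl fun i hi => ?_
          have hiS := hDS hi
          refine C.ratio_splice hab hb h i z (hle i hiS) (hgap a haS i hiS) ?_
          rcases hmem i hiS with h' | ⟨c, hc, h'⟩
          · right
            omega
          · rw [← h']
            exact hgap a haS c hc
  have := key S subset_rfl
  simpa using this

/-- The unnormalised divergence contributed by planting at `a` when the states at `a` and `b` are
observed on input `x`. -/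
def cost (a : Fin n) (b : ℕ) (x : Fin n → Fin t) : ℝ := ∑ z, -Real.log (C.ratio a b z x)

lemma cost_nonneg (a : Fin n) (b : ℕ) (x : Fin n → Fin t) : 0 ≤ C.cost a b x := by
  have h1 : ∑ z, (1 - C.ratio a b z x) = 0 := by
    unfold ratio
    rw [Finset.sum_sub_distrib, ← Finset.sum_div, Finset.sum_add_distrib, ← Finset.mul_sum,
      C.sum_postAt]
    simp
  rw [← h1]
  refine Finset.sum_le_sum fun z _ => ?_
  have := Real.log_le_sub_one_of_pos (C.ratio_pos a b z x)
  linarith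

lemma sum_cost_le (a : Fin n) {b : ℕ} (hab : a < b) (hb : b ≤ n) :
    ∑ x, C.cost a b x ≤ t * ∑ x, Real.log (t * C.postAt a b (x a) x) := by
  have h1 : ∀ x, C.cost a b x ≤
      ∑ z, (t * C.postAt a b z x) * Real.log (t * C.postAt a b z x) := by
    intro x
    have h0 : ∑ z, (3 / 2 * (1 - t * C.postAt a b z x)) = 0 := by
      rw [← Finset.mul_sum, Finset.sum_sub_distrib, ← Finset.mul_sum, C.sum_postAt]
      simp
    rw [← zero_add (∑ z, (t * C.postAt a b z x) * Real.log (t * C.postAt a b z x)), ← h0,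
      ← Finset.sum_add_distrib]
    refine Finset.sum_le_sum fun z _ => ?_
    have := neg_log_half_le (mul_nonneg (Nat.cast_nonneg t) (C.postAt_nonneg a b z x))
    unfold ratio
    linarith
  refine (Finset.sum_le_sum fun x _ => h1 x).trans_eq ?_
  rw [Finset.sum_comm]
  have h2 : ∀ z, ∑ x, (t * C.postAt a b z x) * Real.log (t * C.postAt a b z x) =
      t * ∑ x : Fin n → Fin t,
        Real.log (t * C.postAt a b z x) * (if x a = z then 1 else 0) := by
    intro z
    rw [C.sum_mul_indicator a hab hb z (fun x => Real.log (t * C.postAt a b z x)), Finset.mul_sum]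
    · refine Finset.sum_congr rfl fun x _ => ?_
      ring
    · intro x y h
      have h' := C.agree_splice hab hb h
      simp only [postAt, h'.1, h'.2]
  simp only [h2]
  rw [← Finset.mul_sum, Finset.sum_comm]
  simp

lemma sum_prod_post_le [Fintype V] (b : ℕ) :
    ∑ x : Fin n → Fin t, ∏ a : Fin n,
      (if a < b then t * C.postAt a b (x a) x else 1) ≤ (Fintype.card V : ℝ) ^ 2 * t ^ n := by
  set r : V → ℕ → Fin t → V → ℝ := fun w a z v =>
    if h : a < b ∧ a < n then t * C.post ⟨a, h.2⟩ b z v w else 1 with hr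
  have hr0 : ∀ w a z v, 0 ≤ r w a z v := by
    intro w a z v
    simp only [hr]
    split_ifs with h
    · exact mul_nonneg (Nat.cast_nonneg t) (C.post_nonneg _ _ _ _ _)
    · norm_num
  have hsum : ∀ w a v, ∑ z, r w a z v ≤ t := by
    intro w a v
    by_cases h : a < b ∧ a < n
    · simp only [hr, dif_pos h]
      rw [← Finset.mul_sum]
      exact mul_le_of_le_one_right (Nat.cast_nonneg t) (C.sum_post_le_one _ _ _ _)
    · simp [hr, dif_neg h]
  have hx : ∀ x : Fin n → Fin t, ∏ a : Fin n, (if a < b then t * C.postAt a b (x a) x else 1) ≤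
      ∑ v, ∑ w, ∏ a : Fin n, r w a (x a) (freeRun C.step v x a) := by
    intro x
    have hP : ∀ v w, 0 ≤ ∏ a : Fin n, r w a (x a) (freeRun C.step v x a) :=
      fun v w => Finset.prod_nonneg fun a _ => hr0 _ _ _ _
    calc _ = ∏ a : Fin n, r (C.traj x b) a (x a) (freeRun C.step (C.traj x 0) x a) := by
          refine Finset.prod_congr rfl fun a _ => ?_
          rw [← C.traj_eq_freeRun x a.2.le]
          by_cases h : a.val < b
          · simp [hr, h, postAt]
          · simp [hr, h]
      _ ≤ ∑ w, ∏ a : Fin n, r w a (x a) (freeRun C.step (C.traj x 0) x a) :=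
          Finset.single_le_sum
            (f := fun w => ∏ a : Fin n, r w a (x a) (freeRun C.step (C.traj x 0) x a))
            (fun w _ => hP _ w) (mem_univ (C.traj x b))
      _ ≤ _ := Finset.single_le_sum
            (f := fun v => ∑ w, ∏ a : Fin n, r w a (x a) (freeRun C.step v x a))
            (fun v _ => Finset.sum_nonneg fun w _ => hP v w) (mem_univ (C.traj x 0))
  calc _ ≤ _ := Finset.sum_le_sum fun x _ => hx x
    _ = ∑ v, ∑ w, ∑ x : Fin n → Fin t, ∏ a : Fin n, r w a (x a) (freeRun C.step v x a) := by
        rw [Finset.sum_comm]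
        exact Finset.sum_congr rfl fun v _ => Finset.sum_comm
    _ ≤ ∑ v : V, ∑ w : V, (t : ℝ) ^ n := Finset.sum_le_sum fun v _ => Finset.sum_le_sum fun w _ =>
        sum_prod_freeRun_le n C.step v (r w) (hr0 w) (hsum w)
    _ = _ := by
        simp
        ring

/-- The states at the two ends of `[0, b)` carry at most `2 log |V|` nats about its entries. -/
lemma sum_log_post_le [Fintype V] [Nonempty V] (ht : 0 < t) (b : ℕ) :
    ∑ a : Fin n, (if a < b then ∑ x : Fin n → Fin t, Real.log (t * C.postAt a b (x a) x) else 0) ≤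
      t ^ n * (2 * Real.log (Fintype.card V)) := by
  have hV : (0 : ℝ) < Fintype.card V := by exact_mod_cast Fintype.card_pos
  have htR : (0 : ℝ) < t := by exact_mod_cast ht
  have e1 : ∑ a : Fin n,
      (if a < b then ∑ x : Fin n → Fin t, Real.log (t * C.postAt a b (x a) x) else 0) =
      ∑ x : Fin n → Fin t,
        Real.log (∏ a : Fin n, (if a < b then t * C.postAt a b (x a) x else 1)) := by
    have : ∀ a : Fin n,
      (if a < b then ∑ x : Fin n → Fin t, Real.log (t * C.postAt a b (x a) x) else 0) =
      ∑ x : Fin n → Fin t, Real.log (if a < b then t * C.postAt a b (x a) x else 1) := by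
      intro a
      split_ifs <;> simp
    simp only [this]
    rw [Finset.sum_comm]
    refine Finset.sum_congr rfl fun x _ => ?_
    rw [Real.log_prod]
    intro a _
    have := C.postAt_self_pos a b x
    split_ifs <;> positivity
  rw [e1]
  have h2 : ∀ x : Fin n → Fin t,
      Real.log (∏ a : Fin n, (if a < b then t * C.postAt a b (x a) x else 1)) ≤
      (∏ a : Fin n, (if a < b then t * C.postAt a b (x a) x else 1)) / (Fintype.card V : ℝ) ^ 2 +
        (2 * Real.log (Fintype.card V) - 1) := by
    intro x
    have hp : 0 < ∏ a : Fin n, (if a < b then t * C.postAt a b (x a) x else 1) := by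
      refine Finset.prod_pos fun a _ => ?_
      have := C.postAt_self_pos a b x
      split_ifs <;> positivity
    have := Real.log_le_sub_one_of_pos (div_pos hp (pow_pos hV 2))
    rw [Real.log_div hp.ne' (pow_pos hV 2).ne', Real.log_pow] at this
    push_cast at this
    linarith
  refine (Finset.sum_le_sum fun x _ => h2 x).trans ?_
  rw [Finset.sum_add_distrib, ← Finset.sum_div]
  have h3 : (∑ x : Fin n → Fin t, ∏ a : Fin n,
      (if a < b then t * C.postAt a b (x a) x else 1)) / (Fintype.card V : ℝ) ^ 2 ≤ t ^ n := by
    rw [div_le_iff₀ (pow_pos hV 2), mul_comm]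
    exact C.sum_prod_post_le b
  have h4 : ∑ _x : Fin n → Fin t, (2 * Real.log (Fintype.card V) - 1 : ℝ) =
      t ^ n * (2 * Real.log (Fintype.card V) - 1) := by
    simp
    ring
  rw [h4]
  linarith

end CyclicRun

/-- The element of `S` following `j`, or `n` if there is none. -/
def nextIn {n : ℕ} (S : Finset (Fin n)) (j : Fin n) : ℕ :=
  if h : (S.filter (j < ·)).Nonempty then ((S.filter (j < ·)).min' h).val else n

lemma lt_nextIn {n : ℕ} (S : Finset (Fin n)) (j : Fin n) : j < nextIn S j := by
  unfold nextIn
  split_ifs with h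
  · exact Fin.lt_def.1 (mem_filter.1 (Finset.min'_mem _ h)).2
  · exact j.2

lemma nextIn_le {n : ℕ} (S : Finset (Fin n)) (j : Fin n) : nextIn S j ≤ n := by
  unfold nextIn
  split_ifs with h
  · exact Fin.is_le'
  · exact le_rfl

lemma le_or_nextIn_le {n : ℕ} (S : Finset (Fin n)) (j : Fin n) {i : Fin n} (hi : i ∈ S) :
    i.val ≤ j ∨ nextIn S j ≤ i := by
  rcases le_or_gt i j with h | h
  · exact Or.inl h
  · right
    have hm : i ∈ S.filter (j < ·) := mem_filter.2 ⟨hi, h⟩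
    rw [nextIn, dif_pos ⟨i, hm⟩]
    exact Fin.le_def.1 (Finset.min'_le _ _ hm)

lemma nextIn_eq_or_mem {n : ℕ} (S : Finset (Fin n)) (j : Fin n) :
    nextIn S j = n ∨ ∃ b ∈ S, b.val = nextIn S j := by
  unfold nextIn
  split_ifs with h
  · exact Or.inr ⟨_, (mem_filter.1 (Finset.min'_mem _ h)).1, rfl⟩
  · exact Or.inl rfl

/-- A random subset including each element independently with probability `r` contains `A` with
probability `r ^ #A`. -/
lemma sum_weight_of_subset {n : ℕ} (r : ℝ) (A : Finset (Fin n)) :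
    ∑ S : Finset (Fin n), ((∏ _i ∈ S, r) * ∏ _i ∈ univ \ S, (1 - r)) *
      (if A ⊆ S then 1 else 0) = r ^ A.card := by
  have h := Finset.prod_add (fun _ : Fin n => r) (fun i => if i ∈ A then 0 else 1 - r) univ
  have e : ∏ i : Fin n, (r + if i ∈ A then 0 else 1 - r) = r ^ A.card := by
    have : ∀ i : Fin n, (r + if i ∈ A then 0 else 1 - r) = if i ∈ A then r else 1 := by
      intro i
      split_ifs <;> ring
    simp only [this]
    rw [Finset.prod_ite_mem]
    simp
  rw [e, Finset.powerset_univ] at h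
  rw [h]
  refine Finset.sum_congr rfl fun S _ => ?_
  rw [mul_assoc]
  congr 1
  by_cases hA : A ⊆ S
  · rw [if_pos hA, mul_one]
    refine Finset.prod_congr rfl fun i hi => ?_
    rw [if_neg fun h' => (mem_sdiff.1 hi).2 (hA h')]
  · rw [if_neg hA, mul_zero]
    obtain ⟨i, hiA, hiS⟩ := Finset.not_subset.1 hA
    symm
    refine Finset.prod_eq_zero (i := i) (mem_sdiff.2 ⟨mem_univ i, hiS⟩) ?_
    exact if_pos hiA

lemma half_add_half_log_le {y : ℝ} (hy : 0 < y) :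
    1 / 2 + 1 / 2 * (Real.log y - (y - 1)) ≤ min y 1 := by
  refine le_min ?_ ?_
  · have h := Real.log_le_sub_one_of_pos (show 0 < 3 * y by positivity)
    rw [Real.log_mul (by norm_num) hy.ne'] at h
    have h3 : 1 ≤ Real.log 3 := by
      rw [Real.le_log_iff_exp_le (by norm_num)]
      have := Real.exp_one_lt_d9
      linarith
    linarith
  · have := Real.log_le_sub_one_of_pos hy
    linarith

lemma sum_prod_likelihood {n t : ℕ} (S : Finset (Fin n)) (z : Fin t) :
    ∑ x : Fin n → Fin t, ∏ j ∈ S, ((1 + t * (if x j = z then 1 else 0)) / 2 : ℝ) = t ^ n := by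
  have h := Finset.prod_univ_sum (fun _ : Fin n => (univ : Finset (Fin t)))
    (fun j a => if j ∈ S then ((1 + t * (if a = z then 1 else 0)) / 2 : ℝ) else 1)
  rw [Fintype.piFinset_univ] at h
  simp only [Finset.prod_ite_mem, Finset.univ_inter] at h
  rw [← h]
  have : ∀ j : Fin n, ∑ a : Fin t,
      (if j ∈ S then ((1 + t * (if a = z then 1 else 0)) / 2 : ℝ) else 1) = t := by
    intro j
    split_ifs
    · rw [← Finset.sum_div, Finset.sum_add_distrib, ← Finset.mul_sum]
      simp
    · simp
  rw [Finset.prod_congr rfl fun j _ => this j]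
  simp

lemma needlePMF_eq {n t : ℕ} (ht : 0 < t) (q : ℝ) (x : Fin n → Fin t) :
    (t : ℝ) ^ n * needlePMF t n q x = 1 / t * ∑ z : Fin t, ∑ S : Finset (Fin n),
      ((∏ _i ∈ S, (2 * q)) * ∏ _i ∈ univ \ S, (1 - 2 * q)) *
        ∏ j ∈ S, ((1 + t * (if x j = z then 1 else 0)) / 2 : ℝ) := by
  have htR : (0 : ℝ) < t := by exact_mod_cast ht
  unfold needlePMF
  rw [Finset.mul_sum, Finset.mul_sum]
  refine Finset.sum_congr rfl fun z _ => ?_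
  rw [mul_left_comm]
  congr 1
  have hc : (t : ℝ) ^ n = ∏ _j : Fin n, (t : ℝ) := by simp
  rw [hc, ← Finset.prod_mul_distrib]
  have h := Finset.prod_add
    (fun j : Fin n => 2 * q * ((1 + t * (if x j = z then 1 else 0)) / 2 : ℝ))
    (fun _ => 1 - 2 * q) univ
  rw [Finset.powerset_univ] at h
  calc _ = ∏ j : Fin n,
        (2 * q * ((1 + t * (if x j = z then 1 else 0)) / 2 : ℝ) + (1 - 2 * q)) := by
        refine Finset.prod_congr rfl fun j _ => ?_
        split_ifs
        · field_simp
          ring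
        · field_simp
          ring
    _ = _ := by
        rw [h]
        refine Finset.sum_congr rfl fun S _ => ?_
        rw [Finset.prod_mul_distrib]
        ring

lemma sum_needlePMF {n t : ℕ} (ht : 0 < t) (q : ℝ) :
    ∑ x : Fin n → Fin t, (t : ℝ) ^ n * needlePMF t n q x = t ^ n := by
  have htR : (0 : ℝ) < t := by exact_mod_cast ht
  simp only [needlePMF_eq ht]
  rw [← Finset.mul_sum, Finset.sum_comm]
  have : ∀ z : Fin t, ∑ x : Fin n → Fin t, ∑ S : Finset (Fin n),
      ((∏ _i ∈ S, (2 * q)) * ∏ _i ∈ univ \ S, (1 - 2 * q)) *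
        ∏ j ∈ S, ((1 + t * (if x j = z then 1 else 0)) / 2 : ℝ) = t ^ n := by
    intro z
    rw [Finset.sum_comm]
    simp only [← Finset.mul_sum, sum_prod_likelihood]
    rw [← Finset.sum_mul]
    have := sum_weight_of_subset (2 * q) (∅ : Finset (Fin n))
    simp only [Finset.empty_subset, if_true, mul_one, Finset.card_empty, pow_zero] at this
    rw [this, one_mul]
  simp only [this]
  simp
  field_simp

lemma pow_le_needlePMF {n t : ℕ} (ht : 0 < t) {q : ℝ} (hq0 : 0 ≤ q) (hq1 : q ≤ 1)
    (x : Fin n → Fin t) : (1 - q) ^ n ≤ (t : ℝ) ^ n * needlePMF t n q x := by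
  have htR : (0 : ℝ) < t := by exact_mod_cast ht
  have h : ∀ z : Fin t, ((1 - q) / t) ^ n ≤
      ∏ j : Fin n, (if x j = z then q + (1 - q) / t else (1 - q) / t) := by
    intro z
    have h1 : 0 ≤ (1 - q) / t := div_nonneg (by linarith) htR.le
    calc ((1 - q) / t) ^ n = ∏ _j : Fin n, ((1 - q) / t) := by
          rw [Finset.prod_const, Finset.card_univ, Fintype.card_fin]
      _ ≤ _ := by
        refine Finset.prod_le_prod (fun _ _ => h1) fun j _ => ?_
        split_ifs <;> linarith
  have h2 : ((1 - q) / t) ^ n ≤ needlePMF t n q x := by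
    calc ((1 - q) / t) ^ n = ∑ _z : Fin t, 1 / (t : ℝ) * ((1 - q) / t) ^ n := by
          simp
          field_simp
      _ ≤ _ := Finset.sum_le_sum fun z _ => mul_le_mul_of_nonneg_left (h z) (by positivity)
  calc (1 - q) ^ n = (t : ℝ) ^ n * ((1 - q) / t) ^ n := by
        rw [div_pow]
        field_simp
    _ ≤ _ := mul_le_mul_of_nonneg_left h2 (by positivity)

namespace CyclicRun

variable {n t : ℕ} {V : Type} (C : CyclicRun n t V)

lemma sum_sum_cost_le [Fintype V] [Nonempty V] (ht : 0 < t) {b : ℕ} (hb : b ≤ n) :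
    ∑ a : Fin n, (if a < b then ∑ x, C.cost a b x else 0) ≤
      t ^ (n + 1) * (2 * Real.log (Fintype.card V)) := by
  calc _ ≤ ∑ a : Fin n, t * (if a < b then
        ∑ x : Fin n → Fin t, Real.log (t * C.postAt a b (x a) x) else 0) := by
        refine Finset.sum_le_sum fun a _ => ?_
        split_ifs with h
        · exact C.sum_cost_le a h hb
        · simp
    _ ≤ t * (t ^ n * (2 * Real.log (Fintype.card V))) := by
        rw [← Finset.mul_sum]
        exact mul_le_mul_of_nonneg_left (C.sum_log_post_le ht b) (Nat.cast_nonneg t)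
    _ = _ := by ring

/-- Testing error for a fixed set `S` of planted positions, summed over needles and streams. -/
lemma sum_error_ge (S : Finset (Fin n)) (g : V → ℝ) (hg0 : ∀ v, 0 ≤ g v)
    (hg1 : ∀ v, g v ≤ 1) :
    (t : ℝ) ^ (n + 1) / 2 - 1 / 2 * ∑ j ∈ S, ∑ x, C.cost j (nextIn S j) x ≤
      ∑ z : Fin t, ∑ x : Fin n → Fin t, (g (C.traj x n) + (1 - g (C.traj x n)) *
        ∏ j ∈ S, ((1 + t * (if x j = z then 1 else 0)) / 2 : ℝ)) := by
  have replace := fun (z : Fin t) (g : V → ℝ) => C.sum_mul_prod_likelihood S (nextIn S)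
    (fun j _ => lt_nextIn S j) (fun j _ => nextIn_le S j) (fun j _ i hi => le_or_nextIn_le S j hi)
    (fun j _ => nextIn_eq_or_mem S j) z g
  have hz : ∀ z : Fin t, (t : ℝ) ^ n / 2 +
      1 / 2 * ∑ j ∈ S, ∑ x, Real.log (C.ratio j (nextIn S j) z x) ≤
      ∑ x : Fin n → Fin t, (g (C.traj x n) + (1 - g (C.traj x n)) *
        ∏ j ∈ S, ((1 + t * (if x j = z then 1 else 0)) / 2 : ℝ)) := by
    intro z
    have hY : ∑ x, ∏ j ∈ S, C.ratio j (nextIn S j) z x = (t : ℝ) ^ n := by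
      have := replace z fun _ => 1
      simp only [one_mul] at this
      rw [← this, sum_prod_likelihood]
    rw [Finset.sum_add_distrib, replace z (fun v => 1 - g v), ← Finset.sum_add_distrib]
    calc _ = ∑ x : Fin n → Fin t, (1 / 2 + 1 / 2 *
          (Real.log (∏ j ∈ S, C.ratio j (nextIn S j) z x) -
            (∏ j ∈ S, C.ratio j (nextIn S j) z x - 1))) := by
          have : ∀ x, Real.log (∏ j ∈ S, C.ratio j (nextIn S j) z x) =
              ∑ j ∈ S, Real.log (C.ratio j (nextIn S j) z x) :=
            fun x => Real.log_prod fun j _ => (C.ratio_pos _ _ _ _).ne'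
          simp only [this]
          rw [Finset.sum_add_distrib, ← Finset.mul_sum, Finset.sum_sub_distrib,
            Finset.sum_sub_distrib, hY, Finset.sum_comm]
          simp
          ring
      _ ≤ _ := by
          refine Finset.sum_le_sum fun x _ => ?_
          have hp : 0 < ∏ j ∈ S, C.ratio j (nextIn S j) z x :=
            Finset.prod_pos fun j _ => C.ratio_pos _ _ _ _
          refine (half_add_half_log_le hp).trans ?_
          have h0 := hg0 (C.traj x n)
          have h1 := hg1 (C.traj x n)
          have m1 := min_le_left (∏ j ∈ S, C.ratio j (nextIn S j) z x) 1
          have m2 := min_le_right (∏ j ∈ S, C.ratio j (nextIn S j) z x) 1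
          nlinarith
  refine le_trans (le_of_eq ?_) (Finset.sum_le_sum fun z _ => hz z)
  rw [Finset.sum_add_distrib, ← Finset.mul_sum]
  have : ∑ z : Fin t, ∑ j ∈ S, ∑ x, Real.log (C.ratio j (nextIn S j) z x) =
      -∑ j ∈ S, ∑ x, C.cost j (nextIn S j) x := by
    unfold cost
    rw [Finset.sum_comm, ← Finset.sum_neg_distrib]
    refine Finset.sum_congr rfl fun j _ => ?_
    rw [Finset.sum_comm, ← Finset.sum_neg_distrib]
    refine Finset.sum_congr rfl fun x _ => ?_
    rw [Finset.sum_neg_distrib, neg_neg]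
  rw [this]
  simp
  ring

/-- Lower bound on the testing error of a deterministic multi-pass computation. -/
theorem error_ge [Fintype V] [Nonempty V] (ht : 0 < t) {q : ℝ} (hq0 : 0 ≤ q) (hq : q ≤ 1 / 2)
    (g : V → ℝ) (hg0 : ∀ v, 0 ≤ g v) (hg1 : ∀ v, g v ≤ 1) :
    (t : ℝ) ^ n * (1 / 2 - (2 * q + 4 * q ^ 2 * n) * Real.log (Fintype.card V)) ≤
      ∑ x : Fin n → Fin t, (g (C.traj x n) + (1 - g (C.traj x n)) *
        ((t : ℝ) ^ n * needlePMF t n q x)) := by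
  have htR : (0 : ℝ) < t := by exact_mod_cast ht
  set W : Finset (Fin n) → ℝ := fun S => (∏ _i ∈ S, (2 * q)) * ∏ _i ∈ univ \ S, (1 - 2 * q) with hW
  set K : Fin n → ℕ → ℝ := fun a b => if a < b then ∑ x, C.cost a b x else 0 with hK
  have hW0 : ∀ S, 0 ≤ W S := fun S => mul_nonneg (Finset.prod_nonneg fun _ _ => by linarith)
    (Finset.prod_nonneg fun _ _ => by linarith)
  have hK0 : ∀ a b, 0 ≤ K a b := by
    intro a b
    simp only [hK]
    split_ifs
    · exact Finset.sum_nonneg fun x _ => C.cost_nonneg _ _ _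
    · exact le_rfl
  have hWsub : ∀ A : Finset (Fin n), ∑ S, W S * (if A ⊆ S then 1 else 0) = (2 * q) ^ A.card :=
    sum_weight_of_subset (2 * q)
  have hWone : ∑ S, W S = 1 := by
    have := hWsub ∅
    simpa using this
  set Er : Finset (Fin n) → ℝ := fun S => ∑ z : Fin t, ∑ x : Fin n → Fin t,
    (g (C.traj x n) + (1 - g (C.traj x n)) *
      ∏ j ∈ S, ((1 + t * (if x j = z then 1 else 0)) / 2 : ℝ)) with hEr
  have hmix : ∑ x : Fin n → Fin t, (g (C.traj x n) + (1 - g (C.traj x n)) *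
        ((t : ℝ) ^ n * needlePMF t n q x)) = 1 / t * ∑ S, W S * Er S := by
    have e1 : ∀ x : Fin n → Fin t, g (C.traj x n) + (1 - g (C.traj x n)) *
        ((t : ℝ) ^ n * needlePMF t n q x) = 1 / t * ∑ S, W S * ∑ z : Fin t,
        (g (C.traj x n) + (1 - g (C.traj x n)) *
      ∏ j ∈ S, ((1 + t * (if x j = z then 1 else 0)) / 2 : ℝ)) := by
      intro x
      rw [needlePMF_eq ht, Finset.sum_comm]
      have e2 : ∀ S : Finset (Fin n), W S * ∑ z : Fin t,
        (g (C.traj x n) + (1 - g (C.traj x n)) *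
          ∏ j ∈ S, ((1 + t * (if x j = z then 1 else 0)) / 2 : ℝ)) =
          t * g (C.traj x n) * W S + (1 - g (C.traj x n)) * ∑ z : Fin t, W S *
          ∏ j ∈ S, ((1 + t * (if x j = z then 1 else 0)) / 2 : ℝ) := by
        intro S
        rw [Finset.sum_add_distrib, ← Finset.mul_sum, ← Finset.mul_sum]
        simp
        ring
      simp only [e2]
      rw [Finset.sum_add_distrib, ← Finset.mul_sum, ← Finset.mul_sum, hWone]
      simp only [hW]
      field_simp
    simp only [e1, ← Finset.mul_sum]
    congr 1
    rw [Finset.sum_comm]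
    refine Finset.sum_congr rfl fun S _ => ?_
    rw [← Finset.mul_sum, Finset.sum_comm]
  have hnext : ∀ (S : Finset (Fin n)), ∀ j ∈ S, ∑ x, C.cost j (nextIn S j) x ≤
      K j n + ∑ b ∈ S, K j b := by
    intro S j hj
    have e : ∑ x, C.cost j (nextIn S j) x = K j (nextIn S j) := by
      simp only [hK]
      rw [if_pos (lt_nextIn S j)]
    rw [e]
    rcases nextIn_eq_or_mem S j with h | ⟨b, hb, h⟩
    · rw [h]
      have := Finset.sum_nonneg fun b (_ : b ∈ S) => hK0 j b
      linarith
    · rw [← h]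
      have := Finset.single_le_sum (f := fun b : Fin n => K j b) (fun b _ => hK0 j b) hb
      have := hK0 j n
      linarith
  have hcost : ∑ S, W S * ∑ j ∈ S, ∑ x, C.cost j (nextIn S j) x ≤
      (2 * q + 4 * q ^ 2 * n) * (t ^ (n + 1) * (2 * Real.log (Fintype.card V))) := by
    calc _ ≤ ∑ S, W S * ∑ j ∈ S, (K j n + ∑ b ∈ S, K j b) :=
          Finset.sum_le_sum fun S _ => mul_le_mul_of_nonneg_left
            (Finset.sum_le_sum fun j hj => hnext S j hj) (hW0 S)
      _ = 2 * q * ∑ j : Fin n, K j n +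
          ∑ j : Fin n, ∑ b : Fin n, (2 * q) ^ ({j, b} : Finset (Fin n)).card * K j b := by
          have e1 : ∀ S : Finset (Fin n), W S * ∑ j ∈ S, (K j n + ∑ b ∈ S, K j b) =
              ∑ j : Fin n, W S * (if ({j} : Finset (Fin n)) ⊆ S then 1 else 0) * K j n +
              ∑ j : Fin n, ∑ b : Fin n,
                W S * (if ({j, b} : Finset (Fin n)) ⊆ S then 1 else 0) * K j b := by
            intro S
            rw [Finset.sum_add_distrib, mul_add]
            congr 1
            · rw [Finset.mul_sum, ← Finset.sum_subset (Finset.subset_univ S)]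
              · refine Finset.sum_congr rfl fun j hj => ?_
                simp [hj]
              · intro j _ hj
                simp [hj]
            · rw [Finset.mul_sum, ← Finset.sum_subset (Finset.subset_univ S)]
              · refine Finset.sum_congr rfl fun j hj => ?_
                rw [Finset.mul_sum, ← Finset.sum_subset (Finset.subset_univ S)]
                · refine Finset.sum_congr rfl fun b hb => ?_
                  simp [Finset.insert_subset_iff, hj, hb]
                · intro b _ hb
                  simp [Finset.insert_subset_iff, hb]
              · intro j _ hj
                simp [Finset.insert_subset_iff, hj]
          simp only [e1]
          rw [Finset.sum_add_distrib, Finset.sum_comm]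
          congr 1
          · rw [Finset.mul_sum]
            refine Finset.sum_congr rfl fun j _ => ?_
            rw [← Finset.sum_mul, hWsub]
            simp
          · rw [Finset.sum_comm]
            refine Finset.sum_congr rfl fun j _ => ?_
            rw [Finset.sum_comm]
            refine Finset.sum_congr rfl fun b _ => ?_
            rw [← Finset.sum_mul, hWsub]
      _ = 2 * q * ∑ j : Fin n, K j n + (2 * q) ^ 2 * ∑ b : Fin n, ∑ j : Fin n, K j b := by
          congr 1
          rw [Finset.sum_comm, Finset.mul_sum]
          refine Finset.sum_congr rfl fun b _ => ?_
          rw [Finset.mul_sum]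
          refine Finset.sum_congr rfl fun j _ => ?_
          by_cases h : j = b
          · simp [h, hK]
          · rw [Finset.card_pair h]
      _ ≤ 2 * q * (t ^ (n + 1) * (2 * Real.log (Fintype.card V))) +
          (2 * q) ^ 2 * ∑ _b : Fin n, (t ^ (n + 1) * (2 * Real.log (Fintype.card V)) : ℝ) := by
          gcongr with b
          · exact C.sum_sum_cost_le ht le_rfl
          · exact C.sum_sum_cost_le ht b.2.le
      _ = _ := by
          simp
          ring
  have hlow : ∑ S, W S * ((t : ℝ) ^ (n + 1) / 2 -
      1 / 2 * ∑ j ∈ S, ∑ x, C.cost j (nextIn S j) x) ≤ ∑ S, W S * Er S :=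
    Finset.sum_le_sum fun S _ =>
      mul_le_mul_of_nonneg_left (C.sum_error_ge S g hg0 hg1) (hW0 S)
  have hexp : ∑ S, W S * ((t : ℝ) ^ (n + 1) / 2 -
      1 / 2 * ∑ j ∈ S, ∑ x, C.cost j (nextIn S j) x) =
      t ^ (n + 1) / 2 - 1 / 2 * ∑ S, W S * ∑ j ∈ S, ∑ x, C.cost j (nextIn S j) x := by
    have : ∀ S, W S * ((t : ℝ) ^ (n + 1) / 2 -
      1 / 2 * ∑ j ∈ S, ∑ x, C.cost j (nextIn S j) x) = W S * (t ^ (n + 1) / 2) -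
      1 / 2 * (W S * ∑ j ∈ S, ∑ x, C.cost j (nextIn S j) x) := fun S => by ring
    simp only [this]
    rw [Finset.sum_sub_distrib, ← Finset.sum_mul, ← Finset.mul_sum, hWone, one_mul]
  rw [hmix, one_div_mul_eq_div, le_div_iff₀ htR]
  refine le_trans ?_ (hexp.symm.le.trans hlow)
  have hring : (t : ℝ) ^ n *
      (1 / 2 - (2 * q + 4 * q ^ 2 * n) * Real.log (Fintype.card V)) * t = t ^ (n + 1) / 2 -
      1 / 2 * ((2 * q + 4 * q ^ 2 * n) * (t ^ (n + 1) * (2 * Real.log (Fintype.card V)))) := by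
    ring
  linarith

end CyclicRun

section Deterministic

variable {n t : ℕ} {Q : Type}

/-- One pass of a deterministic algorithm with transitions `f`, started from the state `m`. -/
def detPass (f : ℕ → Fin t → Q → Q) (x : Fin n → Fin t) (m : Q) : ℕ → Q
  | 0 => m
  | j + 1 => if h : j < n then f j (x ⟨j, h⟩) (detPass f x m j) else detPass f x m j

/-- The state of a deterministic algorithm after a given number of passes. -/
def detEnd (f : ℕ → ℕ → Fin t → Q → Q) (x : Fin n → Fin t) (m : Q) : ℕ → Q
  | 0 => m
  | i + 1 => detPass (f i) x (detEnd f x m i) n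

lemma eq_detPass (f : ℕ → Fin t → Q → Q) (x : Fin n → Fin t) (m : Q) (v : ℕ → Q) (h0 : v 0 = m)
    (hv : ∀ j : Fin n, v (j + 1) = f j (x j) (v j)) {j : ℕ} (hj : j ≤ n) :
    v j = detPass f x m j := by
  induction j with
  | zero => exact h0
  | succ j ih =>
    rw [detPass, dif_pos (by omega), ← ih (by omega)]
    exact hv ⟨j, by omega⟩

/-- The states of all passes of a deterministic algorithm, arranged by position. -/
def detRun (n k : ℕ) (f : ℕ → ℕ → Fin t → Q → Q) (m : Q) : CyclicRun n t (Fin k → Q) where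
  step j z v i := f i j z (v i)
  bdry v w := ∀ i : Fin k, (i.val = 0 → v i = m) ∧ ∀ i' : Fin k, i'.val + 1 = i → v i = w i'
  traj x j i := detPass (f i) x (detEnd f x m i) j
  traj_succ x j := by
    funext i
    simp [detPass]
  traj_bdry x := by
    intro i
    refine ⟨fun hi => ?_, fun i' hi => ?_⟩
    · simp [hi, detPass, detEnd]
    · simp [← hi, detPass, detEnd]
  traj_unique := by
    intro x v hv hb
    have key : ∀ (i : ℕ) (hi : i < k), ∀ j ≤ n,
        v j ⟨i, hi⟩ = detPass (f i) x (detEnd f x m i) j := by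
      intro i
      induction i with
      | zero =>
        intro hi j hj
        exact eq_detPass (f 0) x _ (fun j => v j ⟨0, hi⟩) ((hb ⟨0, hi⟩).1 rfl)
          (fun j => congrFun (hv j) ⟨0, hi⟩) hj
      | succ i ih =>
        intro hi j hj
        refine eq_detPass (f (i + 1)) x _ (fun j => v j ⟨i + 1, hi⟩) ?_
          (fun j => congrFun (hv j) ⟨i + 1, hi⟩) hj
        rw [detEnd, ← ih (by omega) n le_rfl]
        exact (hb ⟨i + 1, hi⟩).2 ⟨i, by omega⟩ rfl
    intro j hj
    funext i
    exact key i i.2 j hj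

/-- A deterministic `k`-pass algorithm with `s` bits of memory and `k s q² n < 1 / 64` has constant
testing error. -/
lemma det_error_ge [Fintype Q] (ht : 0 < t) (hn : 1 ≤ n) {q : ℝ} (hq0 : 0 < q) (hq1 : q < 1)
    {k s : ℕ} (hcard : Fintype.card Q ≤ 2 ^ s) (hsmall : (k : ℝ) * s * q ^ 2 * n < 1 / 64)
    (f : ℕ → ℕ → Fin t → Q → Q) (m : Q) (g : Q → ℝ) (hg0 : ∀ v, 0 ≤ g v) (hg1 : ∀ v, g v ≤ 1) :
    (t : ℝ) ^ n / 4 ≤ ∑ x : Fin n → Fin t, (g (detEnd f x m k) + (1 - g (detEnd f x m k)) *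
        ((t : ℝ) ^ n * needlePMF t n q x)) := by
  have htR : (0 : ℝ) < t := by exact_mod_cast ht
  have hnR : (1 : ℝ) ≤ n := by exact_mod_cast hn
  have hpow : (0 : ℝ) < (t : ℝ) ^ n := by positivity
  by_cases hks : k = 0 ∨ s = 0
  · obtain ⟨c, hc⟩ : ∃ c, ∀ x : Fin n → Fin t, detEnd f x m k = c := by
      rcases hks with rfl | rfl
      · exact ⟨m, fun x => rfl⟩
      · have : Subsingleton Q := Fintype.card_le_one_iff_subsingleton.1 (by simpa using hcard)
        exact ⟨m, fun x => Subsingleton.elim _ _⟩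
    simp only [hc]
    rw [Finset.sum_add_distrib, ← Finset.mul_sum, sum_needlePMF ht]
    simp
    nlinarith
  · push Not at hks
    obtain ⟨hk, hs⟩ := hks
    have hk1 : (1 : ℝ) ≤ k := by exact_mod_cast Nat.one_le_iff_ne_zero.2 hk
    have hs1 : (1 : ℝ) ≤ s := by exact_mod_cast Nat.one_le_iff_ne_zero.2 hs
    have hks1 : (1 : ℝ) ≤ k * s := by nlinarith
    have hq2 : q ^ 2 * n < 1 / 64 := by
      have : 0 ≤ q ^ 2 * n := by positivity
      nlinarith
    have hqhalf : q ≤ 1 / 2 := by nlinarith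
    by_cases hqn : q * n < 1 / 2
    · have hb : 1 / 2 ≤ (1 - q) ^ n := by
        have := one_add_mul_le_pow (show (-2 : ℝ) ≤ -q by linarith) n
        rw [← sub_eq_add_neg] at this
        linarith
      have hx : ∀ x : Fin n → Fin t, (1 / 2 : ℝ) ≤
          g (detEnd f x m k) + (1 - g (detEnd f x m k)) * ((t : ℝ) ^ n * needlePMF t n q x) := by
        intro x
        have h1 := pow_le_needlePMF ht hq0.le hq1.le x
        have h2 := hg0 (detEnd f x m k)
        have h3 := hg1 (detEnd f x m k)
        nlinarith
      calc (t : ℝ) ^ n / 4 ≤ ∑ _x : Fin n → Fin t, (1 / 2 : ℝ) := by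
            simp
            linarith
        _ ≤ _ := Finset.sum_le_sum fun x _ => hx x
    · push Not at hqn
      have : Nonempty Q := ⟨m⟩
      have hlast : k - 1 < k := by omega
      have h := (detRun n k f m).error_ge ht hq0.le hqhalf (fun v => g (v ⟨k - 1, hlast⟩))
        (fun v => hg0 _) (fun v => hg1 _)
      have hend : ∀ x : Fin n → Fin t,
          (detRun n k f m).traj x n ⟨k - 1, hlast⟩ = detEnd f x m k := by
        intro x
        obtain ⟨k, rfl⟩ := Nat.exists_eq_succ_of_ne_zero hk
        rfl
      simp only [hend] at h
      refine le_trans ?_ h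
      have hlog : Real.log (Fintype.card (Fin k → Q)) ≤ k * s := by
        rw [Fintype.card_fun, Fintype.card_fin, Nat.cast_pow, Real.log_pow]
        have h1 : Real.log (Fintype.card Q) ≤ s := by
          calc Real.log (Fintype.card Q) ≤ Real.log ((2 : ℝ) ^ s) := by
                refine Real.log_le_log (by exact_mod_cast Fintype.card_pos) ?_
                exact_mod_cast hcard
            _ = s * Real.log 2 := Real.log_pow _ _
            _ ≤ s := mul_le_of_le_one_right (Nat.cast_nonneg s) (by
                have := Real.log_two_lt_d9
                linarith)
        exact mul_le_mul_of_nonneg_left h1 (Nat.cast_nonneg k)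
      have hcoef : 2 * q + 4 * q ^ 2 * n ≤ 8 * (q ^ 2 * n) := by nlinarith
      have hprod : (2 * q + 4 * q ^ 2 * n) * Real.log (Fintype.card (Fin k → Q)) ≤ 1 / 4 := by
        calc _ ≤ (2 * q + 4 * q ^ 2 * n) * (k * s) :=
              mul_le_mul_of_nonneg_left hlog (by positivity)
          _ ≤ 8 * (q ^ 2 * n) * (k * s) := mul_le_mul_of_nonneg_right hcoef (by positivity)
          _ ≤ 1 / 4 := by nlinarith
      nlinarith

end Deterministic

section Averaging

lemma pr_nonneg {Ω : Type} [Fintype Ω] {p : Ω → ℝ} (hp : IsPMF p) (E : Ω → Prop) : 0 ≤ pr p E :=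
  Finset.sum_nonneg fun ω _ => by split_ifs <;> simp [hp.nonneg ω]

lemma pr_mono {Ω : Type} [Fintype Ω] {p : Ω → ℝ} (hp : IsPMF p) {E F : Ω → Prop}
    (h : ∀ ω, E ω → F ω) : pr p E ≤ pr p F :=
  Finset.sum_le_sum fun ω _ => by
    have h0 := hp.nonneg ω
    by_cases hE : E ω
    · simp [hE, h ω hE]
    · rw [if_neg hE]
      split_ifs <;> simp [h0]

/-- The law of the unconscious statistician on a finite sample space. -/
lemma sum_pr_mul {Ω β : Type} [Fintype Ω] [Fintype β] (p : Ω → ℝ) (A : Ω → β) (h : β → ℝ) :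
    ∑ b, pr p (fun ω => A ω = b) * h b = ∑ ω, p ω * h (A ω) := by
  simp only [pr, Finset.sum_mul]
  rw [Finset.sum_comm]
  refine Finset.sum_congr rfl fun ω _ => ?_
  simp [ite_mul]

lemma sum_pr_and {Ω β : Type} [Fintype Ω] [Fintype β] (p : Ω → ℝ) (A : Ω → β) (E : Ω → Prop) :
    ∑ b, pr p (fun ω => E ω ∧ A ω = b) = pr p E := by
  simp only [pr]
  rw [Finset.sum_comm]
  refine Finset.sum_congr rfl fun ω _ => ?_
  by_cases hE : E ω <;> simp [hE]

variable {Ω : Type} [Fintype Ω] {p : Ω → ℝ} {t n k : ℕ} {X : ℕ → Ω → Fin t}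

/-- The initial state together with all random seeds used by the algorithm. -/
def Alg.seeds (M : Alg Ω p (Fin t) n k X) (ω : Ω) : M.S × (Fin k → Fin n → M.Rv) :=
  (M.init ω, fun i j => M.R i j ω)

/-- The deterministic transitions obtained by fixing all random seeds. -/
def Alg.fixSeeds (M : Alg Ω p (Fin t) n k X) (r : Fin k → Fin n → M.Rv) (i j : ℕ)
    (a : Fin t) (m : M.S) : M.S :=
  if h : i < k ∧ j < n then M.f i j a m (r ⟨i, h.1⟩ ⟨j, h.2⟩) else m

lemma Alg.runPass_eq_detPass (M : Alg Ω p (Fin t) n k X) {i : ℕ} (hi : i < k) (ini : Ω → M.S)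
    (ω : Ω) (j : ℕ) :
    M.runPass i ini j ω =
      detPass (M.fixSeeds (M.seeds ω).2 i) (fun j : Fin n => X j ω) (ini ω) j := by
  induction j with
  | zero => rfl
  | succ j ih =>
    by_cases hj : j < n
    · simp [Alg.runPass, detPass, hi, hj, Alg.fixSeeds, Alg.seeds, ih]
    · simp [Alg.runPass, detPass, hj, ih]

lemma Alg.passEnd_eq_detEnd (M : Alg Ω p (Fin t) n k X) (ω : Ω) {i : ℕ} (hi : i ≤ k) :
    M.passEnd i ω =
      detEnd (M.fixSeeds (M.seeds ω).2) (fun j : Fin n => X j ω) (M.seeds ω).1 i := by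
  induction i with
  | zero => rfl
  | succ i ih =>
    rw [Alg.passEnd, M.runPass_eq_detPass (by omega), ih (by omega)]
    rfl

/-- The joint probability mass function of the independent seeds of an algorithm. -/
def Alg.seedPMF (M : Alg Ω p (Fin t) n k X) (c : M.S × (Fin k → Fin n → M.Rv)) : ℝ :=
  pr p (fun ω => M.init ω = c.1) * ∏ i : Fin k, ∏ j : Fin n, pr p (fun ω => M.R i j ω = c.2 i j)

lemma Alg.pr_seeds_and_input (M : Alg Ω p (Fin t) n k X) (hp : IsPMF p) (ht : 0 < t)
    (hX : ∀ x : Fin n → Fin t,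
      pr p (fun ω => ∀ j : Fin n, X j.1 ω = x j) = (1 / (t : ℝ)) ^ n)
    (c : M.S × (Fin k → Fin n → M.Rv)) (x : Fin n → Fin t) :
    pr p (fun ω => (M.seeds ω, fun j : Fin n => X j ω) = (c, x)) =
      M.seedPMF c * (1 / (t : ℝ)) ^ n := by
  have hne : Nonempty Ω := by
    by_contra h
    rw [not_nonempty_iff] at h
    have := hp.sum_one
    simp at this
  obtain ⟨ω₀⟩ := hne
  let r : ℕ → ℕ → M.Rv := fun i j =>
    if h : i < k ∧ j < n then c.2 ⟨i, h.1⟩ ⟨j, h.2⟩ else M.R 0 0 ω₀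
  let y : ℕ → Fin t := fun j => if h : j < n then x ⟨j, h⟩ else ⟨0, ht⟩
  have hxy : ∀ ω, (∀ j < n, X j ω = y j) ↔ ∀ j : Fin n, X j.1 ω = x j := by
    intro ω
    constructor
    · intro h j
      have := h j j.2
      simpa [y] using this
    · intro h j hj
      have := h ⟨j, hj⟩
      simpa [y, hj] using this
  have hr : ∀ ω, (∀ i < k, ∀ j < n, M.R i j ω = r i j) ↔
      (fun (i : Fin k) (j : Fin n) => M.R i j ω) = c.2 := by
    intro ω
    constructor
    · intro h
      funext i j
      have := h i i.2 j j.2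
      simpa [r] using this
    · intro h i hi j hj
      have := congrFun (congrFun h ⟨i, hi⟩) ⟨j, hj⟩
      simpa [r, hi, hj] using this
  have h := M.indep c.1 r y
  simp only [hxy, hr] at h
  rw [hX] at h
  have hprod : (∏ i ∈ Finset.range k, ∏ j ∈ Finset.range n, pr p (fun ω => M.R i j ω = r i j)) =
      ∏ i : Fin k, ∏ j : Fin n, pr p (fun ω => M.R i j ω = c.2 i j) := by
    rw [Finset.prod_range]
    refine Finset.prod_congr rfl fun i _ => ?_
    rw [Finset.prod_range]
    refine Finset.prod_congr rfl fun j _ => ?_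
    simp [r]
  rw [hprod] at h
  rw [Alg.seedPMF, ← h]
  congr 1
  funext ω
  simp only [Alg.seeds, Prod.ext_iff, funext_iff, and_assoc]

/-- The expectation of a function of input and final state, as an average over seeds. -/
lemma Alg.sum_pr_input_final_mul (M : Alg Ω p (Fin t) n k X) (hp : IsPMF p) (ht : 0 < t)
    (hX : ∀ x : Fin n → Fin t,
      pr p (fun ω => ∀ j : Fin n, X j.1 ω = x j) = (1 / (t : ℝ)) ^ n)
    (h : (Fin n → Fin t) → M.S → ℝ) :
    ∑ x : Fin n → Fin t, ∑ m,
        pr p (fun ω => (∀ j : Fin n, X j.1 ω = x j) ∧ M.passEnd k ω = m) * h x m =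
      ∑ c, M.seedPMF c * ((1 / (t : ℝ)) ^ n *
        ∑ x : Fin n → Fin t, h x (detEnd (M.fixSeeds c.2) x c.1 k)) := by
  have h1 := sum_pr_mul p (fun ω => ((fun j : Fin n => X j ω), M.passEnd k ω))
    (fun b => h b.1 b.2)
  have h2 := sum_pr_mul p (fun ω => (M.seeds ω, fun j : Fin n => X j ω))
    (fun b => h b.2 (detEnd (M.fixSeeds b.1.2) b.2 b.1.1 k))
  simp only [M.passEnd_eq_detEnd _ le_rfl] at h1
  rw [← h2, Fintype.sum_prod_type, Fintype.sum_prod_type] at h1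
  simp only [M.pr_seeds_and_input hp ht hX] at h1
  simp only [M.passEnd_eq_detEnd _ le_rfl]
  simp only [Prod.ext_iff, funext_iff] at h1
  rw [h1]
  refine Finset.sum_congr rfl fun c _ => ?_
  rw [Finset.mul_sum, Finset.mul_sum]
  exact Finset.sum_congr rfl fun x _ => by ring

lemma Alg.seedPMF_nonneg (M : Alg Ω p (Fin t) n k X) (hp : IsPMF p)
    (c : M.S × (Fin k → Fin n → M.Rv)) : 0 ≤ M.seedPMF c :=
  mul_nonneg (pr_nonneg hp _)
    (Finset.prod_nonneg fun _ _ => Finset.prod_nonneg fun _ _ => pr_nonneg hp _)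

lemma Alg.sum_seedPMF (M : Alg Ω p (Fin t) n k X) (hp : IsPMF p) (ht : 0 < t)
    (hX : ∀ x : Fin n → Fin t,
      pr p (fun ω => ∀ j : Fin n, X j.1 ω = x j) = (1 / (t : ℝ)) ^ n) :
    ∑ c, M.seedPMF c = 1 := by
  have h := sum_pr_mul p (fun ω => (M.seeds ω, fun j : Fin n => X j ω)) (fun _ => 1)
  rw [Fintype.sum_prod_type] at h
  simp only [M.pr_seeds_and_input hp ht hX, mul_one, hp.sum_one] at h
  have htR : (t : ℝ) ≠ 0 := by exact_mod_cast ht.ne'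
  rw [← h]
  refine Finset.sum_congr rfl fun c _ => ?_
  simp [field]

/-- An output conditionally independent of the input given the final state is a randomized
function of the final state. -/
lemma exists_output_kernel {Ω α S : Type} [Fintype Ω] [Fintype S] {p : Ω → ℝ} (hp : IsPMF p)
    (Out : Ω → Bool) (E : α → Ω → Prop) (F : Ω → S)
    (hci : ∀ (b : Bool) (x : α) (m : S),
      pr p (fun ω => Out ω = b ∧ E x ω ∧ F ω = m) * pr p (fun ω => F ω = m) =
        pr p (fun ω => Out ω = b ∧ F ω = m) * pr p (fun ω => E x ω ∧ F ω = m)) :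
    ∃ g : S → ℝ, (∀ m, 0 ≤ g m) ∧ (∀ m, g m ≤ 1) ∧
      (∀ x m, pr p (fun ω => Out ω = true ∧ E x ω ∧ F ω = m) =
        pr p (fun ω => E x ω ∧ F ω = m) * g m) ∧
      (∀ x m, pr p (fun ω => Out ω = false ∧ E x ω ∧ F ω = m) =
        pr p (fun ω => E x ω ∧ F ω = m) * (1 - g m)) := by
  have htrue : ∀ x m, pr p (fun ω => Out ω = true ∧ E x ω ∧ F ω = m) =
      pr p (fun ω => E x ω ∧ F ω = m) *
        (pr p (fun ω => Out ω = true ∧ F ω = m) / pr p (fun ω => F ω = m)) := by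
    intro x m
    rcases (pr_nonneg hp (fun ω => F ω = m)).eq_or_lt with h0 | hpos
    · rw [← h0, div_zero, mul_zero]
      refine le_antisymm ?_ (pr_nonneg hp _)
      exact (pr_mono hp fun ω hω => hω.2.2).trans h0.symm.le
    · rw [mul_div_assoc', eq_div_iff hpos.ne', hci, mul_comm]
  refine ⟨_, fun m => div_nonneg (pr_nonneg hp _) (pr_nonneg hp _),
    fun m => div_le_one_of_le₀ (pr_mono hp fun ω hω => hω.2) (pr_nonneg hp _), htrue, ?_⟩
  intro x m
  have h := sum_pr_and p Out (fun ω => E x ω ∧ F ω = m)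
  simp only [Fintype.sum_bool, and_comm (b := Out _ = _)] at h
  rw [htrue] at h
  linarith

end Averaging

lemma error_ge_of_small {t n : ℕ} (ht : 0 < t) (hn : 1 ≤ n) {q : ℝ} (hq0 : 0 < q) (hq1 : q < 1)
    {k s : ℕ} {Ω : Type} [Fintype Ω] {p : Ω → ℝ} {X : ℕ → Ω → Fin t}
    (M : Alg Ω p (Fin t) n k X) (Out : Ω → Bool) (hp : IsPMF p)
    (hX : ∀ x : Fin n → Fin t,
      pr p (fun ω => ∀ j : Fin n, X j.1 ω = x j) = (1 / (t : ℝ)) ^ n)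
    (hcard : Fintype.card M.S ≤ 2 ^ s)
    (hci : ∀ (b : Bool) (x : Fin n → Fin t) (m : M.S),
      pr p (fun ω => Out ω = b ∧ (∀ j : Fin n, X j.1 ω = x j) ∧ M.passEnd k ω = m) *
          pr p (fun ω => M.passEnd k ω = m)
        = pr p (fun ω => Out ω = b ∧ M.passEnd k ω = m) *
          pr p (fun ω => (∀ j : Fin n, X j.1 ω = x j) ∧ M.passEnd k ω = m))
    (hsmall : (k : ℝ) * s * q ^ 2 * n < 1 / 64) :
    1 / 4 ≤ pr p (fun ω => Out ω = true)
      + ∑ x : Fin n → Fin t, needlePMF t n q x *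
          (pr p (fun ω => Out ω = false ∧ ∀ j : Fin n, X j.1 ω = x j) /
            pr p (fun ω => ∀ j : Fin n, X j.1 ω = x j)) := by
  have htR : (0 : ℝ) < t := by exact_mod_cast ht
  have hpow : (0 : ℝ) < (t : ℝ) ^ n := by positivity
  obtain ⟨g, hg0, hg1, htrue, hfalse⟩ := exists_output_kernel hp Out
    (fun (x : Fin n → Fin t) ω => ∀ j : Fin n, X j.1 ω = x j) (M.passEnd k) hci
  have h1 : pr p (fun ω => Out ω = true) = ∑ x : Fin n → Fin t, ∑ m,
      pr p (fun ω => (∀ j : Fin n, X j.1 ω = x j) ∧ M.passEnd k ω = m) * g m := by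
    simp only [← htrue]
    rw [← sum_pr_and p (fun ω => fun j : Fin n => X j.1 ω)]
    refine Finset.sum_congr rfl fun x _ => ?_
    rw [← sum_pr_and p (M.passEnd k)]
    simp only [funext_iff, and_assoc]
  have h2 : ∀ x : Fin n → Fin t, needlePMF t n q x *
      (pr p (fun ω => Out ω = false ∧ ∀ j : Fin n, X j.1 ω = x j) /
        pr p (fun ω => ∀ j : Fin n, X j.1 ω = x j)) =
      ∑ m, pr p (fun ω => (∀ j : Fin n, X j.1 ω = x j) ∧ M.passEnd k ω = m) *
        ((1 - g m) * ((t : ℝ) ^ n * needlePMF t n q x)) := by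
    intro x
    rw [hX, one_div_pow, ← sum_pr_and p (M.passEnd k)]
    simp only [and_assoc, hfalse, ← mul_assoc]
    rw [← Finset.sum_mul, ← Finset.sum_mul]
    field_simp
  rw [Finset.sum_congr rfl fun x _ => h2 x, h1, ← Finset.sum_add_distrib]
  simp only [← Finset.sum_add_distrib, ← mul_add]
  rw [M.sum_pr_input_final_mul hp ht hX
    (fun x m => g m + (1 - g m) * ((t : ℝ) ^ n * needlePMF t n q x))]
  calc (1 / 4 : ℝ) = ∑ c, M.seedPMF c * (1 / 4) := by
        rw [← Finset.sum_mul, M.sum_seedPMF hp ht hX, one_mul]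
    _ ≤ _ := Finset.sum_le_sum fun c _ => by
        refine mul_le_mul_of_nonneg_left ?_ (M.seedPMF_nonneg hp c)
        have h := det_error_ge ht hn hq0 hq1 hcard hsmall (M.fixSeeds c.2) c.1 g hg0 hg1
        rw [one_div_pow, one_div_mul_eq_div, le_div_iff₀ hpow]
        linarith

/-- Theorem 1.9 / `streaming_lower_bound`: there is an absolute
constant `c > 0` such that for all `t, n` with `n ≤ t/100` and all `q ∈ (0,1)`, any
`k`-pass streaming algorithm with `s` bits of memory on streams in `[t]^n` — whose output
bit is a (possibly randomized) function of the final memory state — that distinguishes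
the uniform distribution `D0` from the needle distribution `D1` with
`Pr[out = 1 | D0] + Pr[out = 0 | D1] ≤ 0.01` must satisfy `k·s·q²·n ≥ c`.
(The probability of an event `E` under `D1` is expressed as
`Σ_x D1(x)·Pr[E | X = x]`, which is valid since the algorithm's randomness is
independent of its input.) -/
theorem needle_problem_lower_bound :
    ∃ c : ℝ, 0 < c ∧
      ∀ (t n : ℕ), 1 ≤ n → 100 * n ≤ t →
        ∀ q : ℝ, 0 < q → q < 1 →
          ∀ (k s : ℕ) (Ω : Type) [Fintype Ω], ∀ (p : Ω → ℝ) (X : ℕ → Ω → Fin t)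
            (M : Alg Ω p (Fin t) n k X) (Out : Ω → Bool),
            IsPMF p →
            -- the input is distributed according to `D0` (i.i.d. uniform on `[t]`):
            (∀ x : Fin n → Fin t,
              pr p (fun ω => ∀ j : Fin n, X j.1 ω = x j) = (1 / (t : ℝ)) ^ n) →
            Fintype.card M.S ≤ 2 ^ s →
            -- `Out` is conditionally independent of the input given the final state:
            (∀ (b : Bool) (x : Fin n → Fin t) (m : M.S),
              pr p (fun ω => Out ω = b ∧ (∀ j : Fin n, X j.1 ω = x j) ∧
                    M.passEnd k ω = m) *
                  pr p (fun ω => M.passEnd k ω = m)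
                = pr p (fun ω => Out ω = b ∧ M.passEnd k ω = m) *
                  pr p (fun ω => (∀ j : Fin n, X j.1 ω = x j) ∧ M.passEnd k ω = m)) →
            -- the total error for distinguishing `D0` from `D1` is at most `0.01`:
            pr p (fun ω => Out ω = true)
                + (∑ x : Fin n → Fin t, needlePMF t n q x *
                    (pr p (fun ω => Out ω = false ∧ ∀ j : Fin n, X j.1 ω = x j) /
                      pr p (fun ω => ∀ j : Fin n, X j.1 ω = x j)))
              ≤ 0.01 →
            c ≤ (k : ℝ) * s * q ^ 2 * n := by
  refine ⟨1 / 64, by norm_num, ?_⟩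
  intro t n hn hnt q hq0 hq1 k s Ω _ p X M Out hp hX hcard hci herr
  by_contra! hsmall
  have := error_ge_of_small (by omega) hn hq0 hq1 M Out hp hX hcard hci hsmall
  norm_num at herr this
  linarith

end MultiPassIC
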